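/- Let n, m be natural numbers, let g ≥ 3 and h ≥ g be natural numbers, and let D be a finite multiset of natural numbers (the degrees of the inner faces). Assume the Euler relation n - m + (D.card + 1) = 2 holds (as integers), that 2m = h + (sum of the elements of D), that every element of D is at least g, and that m attains the maximum, i.e. (g - 2) * m = g * (n - 2) - (h - g). Then every element of D equals g, i.e. every inner face is a g-cycle. -/

import Mathlib

/-- Converse direction of Theorem 2 of the paper: if the edge count attains the
maximum `(g-2)m = g(n-2) - (h-g)`, then all inner faces have degree exactly `g`. -/
theorem stmt_2 (n m g h : ℕ) (D : Multiset ℕ)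
    (hg : 3 ≤ g) (hh : g ≤ h)
    (euler : (n : ℤ) - m + (Multiset.card D + 1) = 2)
    (edges : 2 * m = h + D.sum)
    (girth : ∀ d ∈ D, g ≤ d)
    (hmax : ((g : ℤ) - 2) * m = g * (n - 2) - (h - g)) :
    ∀ d ∈ D, d = g := by
  intro d hd
  have sum_eq : D.sum = Multiset.card D * g := by
    zify at edges ⊢
    linear_combination -edges - hmax - (g : ℤ) * euler
  obtain ⟨E, rfl⟩ := Multiset.exists_cons_of_mem hd
  have sum_ge : Multiset.card E * g ≤ E.sum := by
    simpa using Multiset.card_nsmul_le_sum (s := E) (a := g)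
      fun x hx => girth x (Multiset.mem_cons_of_mem hx)
  have := girth d hd
  rw [Multiset.sum_cons, Multiset.card_cons, add_mul] at sum_eq
  omega
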